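/- Let r, k, r₁', k₁', r₂', k₂' be positive integers such that r ≥ 2, r₁' ≤ r, r₂' ≤ r, and r₁'·k₁' + r₂'·k₂' ≤ r·k. Then k₁'·(r₁' − 1/r₁') + k₂'·(r₂' − 1/r₂') = k·(r − 1/r) holds (as rational numbers) if and only if r₁' = r, r₂' = r, and k₁' + k₂' = k. -/

import Mathlib

theorem mul_sub_one_div_eq {s : ℚ} (hs : s ≠ 0) (a : ℚ) :
    a * (s - 1 / s) = s * a * (1 - 1 / s ^ 2) := by
  field_simp

theorem mul_sub_one_div_lt {s r a : ℚ} (hs : 0 < s) (hsr : s < r) (ha : 0 < a) :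
    a * (s - 1 / s) < s * a * (1 - 1 / r ^ 2) := by
  rw [mul_sub_one_div_eq hs.ne']
  have : 1 / r ^ 2 < 1 / s ^ 2 := by gcongr
  gcongr

theorem mul_sub_one_div_le {s r a : ℚ} (hs : 0 < s) (hsr : s ≤ r) (ha : 0 < a) :
    a * (s - 1 / s) ≤ s * a * (1 - 1 / r ^ 2) := by
  rcases hsr.lt_or_eq with h | rfl
  · exact (mul_sub_one_div_lt hs h ha).le
  · exact (mul_sub_one_div_eq hs.ne' a).le

theorem stmt_3 (r k r₁' k₁' r₂' k₂' : ℕ)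
    (hr : 2 ≤ r) (hk : 0 < k) (hr₁ : 0 < r₁') (hk₁ : 0 < k₁')
    (hr₂ : 0 < r₂') (hk₂ : 0 < k₂')
    (h₁ : r₁' ≤ r) (h₂ : r₂' ≤ r)
    (hΞ : r₁' * k₁' + r₂' * k₂' ≤ r * k) :
    (k₁' : ℚ) * ((r₁' : ℚ) - 1 / (r₁' : ℚ)) + (k₂' : ℚ) * ((r₂' : ℚ) - 1 / (r₂' : ℚ))
      = (k : ℚ) * ((r : ℚ) - 1 / (r : ℚ))
    ↔ r₁' = r ∧ r₂' = r ∧ k₁' + k₂' = k := by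
  have hrQ : (2 : ℚ) ≤ r := by exact_mod_cast hr
  have hr₁Q : (0 : ℚ) < r₁' := by exact_mod_cast hr₁
  have hr₂Q : (0 : ℚ) < r₂' := by exact_mod_cast hr₂
  have hk₁Q : (0 : ℚ) < k₁' := by exact_mod_cast hk₁
  have hk₂Q : (0 : ℚ) < k₂' := by exact_mod_cast hk₂
  constructor
  · intro h
    have hc : (0 : ℚ) < 1 - 1 / (r : ℚ) ^ 2 := by
      rw [sub_pos, div_lt_one (by positivity)]
      nlinarith
    have hsum : ((r₁' : ℚ) * k₁' + r₂' * k₂') * (1 - 1 / (r : ℚ) ^ 2)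
        ≤ r * k * (1 - 1 / (r : ℚ) ^ 2) :=
      mul_le_mul_of_nonneg_right (by exact_mod_cast hΞ) hc.le
    rw [add_mul] at hsum
    have hk_eq := mul_sub_one_div_eq (s := (r : ℚ)) (by positivity) k
    have hle₁ := mul_sub_one_div_le hr₁Q (Nat.cast_le.mpr h₁) hk₁Q
    have hle₂ := mul_sub_one_div_le hr₂Q (Nat.cast_le.mpr h₂) hk₂Q
    have e₁ : r₁' = r := by
      by_contra hne
      have := mul_sub_one_div_lt hr₁Q (Nat.cast_lt.mpr (lt_of_le_of_ne h₁ hne)) hk₁Q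
      linarith
    have e₂ : r₂' = r := by
      by_contra hne
      have := mul_sub_one_div_lt hr₂Q (Nat.cast_lt.mpr (lt_of_le_of_ne h₂ hne)) hk₂Q
      linarith
    refine ⟨e₁, e₂, ?_⟩
    rw [e₁, e₂, ← add_mul] at h
    have hpos : (0 : ℚ) < r - 1 / r := by
      rw [sub_pos, div_lt_iff₀ (by positivity)]
      nlinarith
    exact_mod_cast mul_right_cancel₀ hpos.ne' h
  · rintro ⟨rfl, rfl, rfl⟩
    push_cast
    ring
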